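/- Let m ∈ ℕ, let I : (0,∞) → (0,∞) be a left-continuous non-decreasing function such that Φ_I^m(t,s) is essentially decreasing in t, and let f be a non-negative measurable function on (0,∞) whose support S_f = {t : f(t) > 0} has finite Lebesgue measure. Then the set E = {t ∈ (0,∞) : R_I^m f*(t) < G_I^m f(t)} is an open subset of (0,∞), and there exists an at most countable collection of pairwise disjoint bounded open intervals {(c_k, d_k)}_{k ∈ K} in (0,∞) such that: E = ∪_{k∈K} (c_k, d_k); G_I^m f(t) = R_I^m f*(t) for every t ∈ (0,∞) \ E; and G_I^m f(t) = R_I^m f*(d_k) for every t ∈ (c_k, d_k) and every k ∈ K. -/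

import Mathlib

open MeasureTheory Set Filter
open scoped ENNReal NNReal Topology

noncomputable section

/-- The distribution function of `f`, viewed as a function on `(0,∞)` with Lebesgue measure:
`μ_f(s) = λ({t ∈ (0,∞) : f(t) > s})`. -/
def distrib (f : ℝ → ℝ≥0∞) (s : ℝ≥0∞) : ℝ≥0∞ :=
  volume {t : ℝ | t ∈ Set.Ioi (0 : ℝ) ∧ s < f t}

/-- The non-increasing rearrangement `f*(t) = inf { s ≥ 0 : μ_f(s) ≤ t }`. -/
def rearr (f : ℝ → ℝ≥0∞) (t : ℝ) : ℝ≥0∞ :=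
  sInf {s : ℝ≥0∞ | distrib f s ≤ ENNReal.ofReal t}

/-- The operator `R_I f(t) = (1/I(t)) ∫_0^t f(s) ds`. -/
def RI (I : ℝ → ℝ) (f : ℝ → ℝ≥0∞) : ℝ → ℝ≥0∞ :=
  fun t => (∫⁻ s in Set.Ioc (0 : ℝ) t, f s) / ENNReal.ofReal (I t)

/-- The operator `H_I f(t) = ∫_t^∞ f(s)/I(s) ds`. -/
def HI (I : ℝ → ℝ) (f : ℝ → ℝ≥0∞) : ℝ → ℝ≥0∞ :=
  fun t => ∫⁻ s in Set.Ioi t, f s / ENNReal.ofReal (I s)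

/-- `G_I^m f(t) = sup_{s ≥ t} R_I^m f*(s)`. -/
def GI (I : ℝ → ℝ) (m : ℕ) (f : ℝ → ℝ≥0∞) : ℝ → ℝ≥0∞ :=
  fun t => ⨆ s ∈ Set.Ici t, (RI I)^[m] (rearr f) s

/-- `Φ_I^m(t,s) = (∫_s^t 1/I(τ) dτ)^(m-1) / I(t)`. -/
def Phi (I : ℝ → ℝ) (m : ℕ) (t s : ℝ) : ℝ :=
  (∫ τ in s..t, 1 / I τ) ^ (m - 1) / I t

/-- `Φ_I^m(t,s)` is essentially decreasing in `t`. -/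
def EssentiallyDecreasingIn (I : ℝ → ℝ) (m : ℕ) : Prop :=
  ∀ s₀ ∈ Set.Ioi (0 : ℝ), ∃ t₀ ∈ Set.Ioi (0 : ℝ), ∀ t ∈ Set.Ioi t₀,
    ∃ rt ∈ Set.Ioi (0 : ℝ), ∀ r ∈ Set.Ioi rt, ∀ s ∈ Set.Ioo (0 : ℝ) s₀,
      Phi I m r s ≤ Phi I m t s

/-- The kernel operator `f ↦ (t ↦ ∫_t^∞ (f(s)/I(s)) (∫_t^s 1/I(r) dr)^(m-1) ds)`. -/
def kernelOp (I : ℝ → ℝ) (m : ℕ) (f : ℝ → ℝ≥0∞) : ℝ → ℝ≥0∞ :=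
  fun t => ∫⁻ s in Set.Ioi t,
    (f s / ENNReal.ofReal (I s)) * (ENNReal.ofReal (∫ r in t..s, 1 / I r)) ^ (m - 1)

/-- A Banach function norm on (non-negative) measurable functions on `(0,∞)`
(with Lebesgue measure). -/
structure BanachFunctionNorm where
  /-- The norm functional. -/
  N : (ℝ → ℝ≥0∞) → ℝ≥0∞
  /-- Positive homogeneity. -/
  smul : ∀ (c : ℝ≥0) (f : ℝ → ℝ≥0∞), Measurable f →
    N (fun t => (c : ℝ≥0∞) * f t) = (c : ℝ≥0∞) * N f
  /-- The norm vanishes exactly on a.e.-zero functions. -/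
  eq_zero_iff : ∀ f : ℝ → ℝ≥0∞, Measurable f →
    (N f = 0 ↔ ∀ᵐ t ∂(volume.restrict (Set.Ioi (0 : ℝ))), f t = 0)
  /-- Subadditivity. -/
  add_le : ∀ f g : ℝ → ℝ≥0∞, Measurable f → Measurable g →
    N (fun t => f t + g t) ≤ N f + N g
  /-- The lattice property. -/
  mono : ∀ f g : ℝ → ℝ≥0∞, Measurable f → Measurable g →
    (∀ᵐ t ∂(volume.restrict (Set.Ioi (0 : ℝ))), f t ≤ g t) → N f ≤ N g
  /-- The Fatou property: `f_n ↑ f` a.e. implies `‖f_n‖ ↑ ‖f‖`. -/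
  fatou : ∀ (f : ℕ → ℝ → ℝ≥0∞) (g : ℝ → ℝ≥0∞), (∀ n, Measurable (f n)) →
    Measurable g →
    (∀ᵐ t ∂(volume.restrict (Set.Ioi (0 : ℝ))), Monotone fun n => f n t) →
    (∀ᵐ t ∂(volume.restrict (Set.Ioi (0 : ℝ))), g t = ⨆ n, f n t) →
    N g = ⨆ n, N (f n)
  /-- Characteristic functions of sets of finite measure have finite norm. -/
  indicator_lt_top : ∀ E : Set ℝ, MeasurableSet E → E ⊆ Set.Ioi (0 : ℝ) →
    volume E < ∞ → N (E.indicator 1) < ∞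
  /-- Local embedding into `L¹`. -/
  exists_integral_le : ∀ E : Set ℝ, MeasurableSet E → E ⊆ Set.Ioi (0 : ℝ) →
    volume E < ∞ → ∃ C : ℝ≥0∞, C ≠ ∞ ∧
      ∀ f : ℝ → ℝ≥0∞, Measurable f → ∫⁻ t in E, f t ≤ C * N f

/-- A rearrangement-invariant Banach function norm: equimeasurable functions have
equal norms. -/
structure RIBanachFunctionNorm extends BanachFunctionNorm where
  /-- Rearrangement invariance. -/
  ri : ∀ f g : ℝ → ℝ≥0∞, Measurable f → Measurable g →
    (∀ s, distrib f s = distrib g s) → N f = N g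

/-- The associate norm `‖f‖_{X'} = sup { ∫_0^∞ |f g| : ‖g‖_X ≤ 1 }`. -/
def assocNorm (X : RIBanachFunctionNorm) (f : ℝ → ℝ≥0∞) : ℝ≥0∞ :=
  ⨆ (g : ℝ → ℝ≥0∞) (_ : Measurable g) (_ : X.N g ≤ 1),
    ∫⁻ t in Set.Ioi (0 : ℝ), f t * g t

/-- The down-associate norm `‖f‖_{X'_d} = sup { ∫_0^∞ |f| g* : ‖g‖_X ≤ 1 }`. -/
def downAssocNorm (X : RIBanachFunctionNorm) (f : ℝ → ℝ≥0∞) : ℝ≥0∞ :=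
  ⨆ (g : ℝ → ℝ≥0∞) (_ : Measurable g) (_ : X.N g ≤ 1),
    ∫⁻ t in Set.Ioi (0 : ℝ), f t * rearr g t

/-- The set `E = {t ∈ (0,∞) : R_I^m f*(t) < G_I^m f(t)}`. -/
def exceptionalSet (I : ℝ → ℝ) (m : ℕ) (f : ℝ → ℝ≥0∞) : Set ℝ :=
  {t : ℝ | t ∈ Set.Ioi (0 : ℝ) ∧ (RI I)^[m] (rearr f) t < GI I m f t}

/-- An open set of positive reals having points of its complement arbitrarily far to the right
is a countable disjoint union of bounded open intervals with endpoints outside the set. -/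
lemma exists_disjoint_Ioo_decomposition {E : Set ℝ} (hE : IsOpen E) (hE0 : E ⊆ Ioi 0)
    (hE' : ∀ t ∈ E, ∃ s, t < s ∧ s ∉ E) :
    ∃ (K : Set ℕ) (c d : ℕ → ℝ), (∀ k ∈ K, 0 ≤ c k ∧ c k < d k) ∧
      (K.PairwiseDisjoint fun k => Ioo (c k) (d k)) ∧ E = ⋃ k ∈ K, Ioo (c k) (d k) ∧
      ∀ k ∈ K, d k ∉ E := by
  let S : Set (ℝ × ℝ) := {p | 0 ≤ p.1 ∧ p.1 < p.2 ∧ p.1 ∉ E ∧ p.2 ∉ E ∧ Ioo p.1 p.2 ⊆ E}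
  have hdisj : S.PairwiseDisjoint fun p => Ioo p.1 p.2 := by
    rintro ⟨a, b⟩ ⟨-, -, ha, hb, hab⟩ ⟨a', b'⟩ ⟨-, -, ha', hb', hab'⟩ hne
    refine Set.disjoint_left.2 fun x ⟨hx1, hx2⟩ ⟨hx3, hx4⟩ => hne ?_
    simp only at *
    have h1 : a = a' := by
      rcases lt_trichotomy a a' with h | h | h
      · exact absurd (hab ⟨h, by linarith⟩) ha'
      · exact h
      · exact absurd (hab' ⟨h, by linarith⟩) ha
    have h2 : b = b' := by
      rcases lt_trichotomy b b' with h | h | h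
      · exact absurd (hab' ⟨by linarith, h⟩) hb
      · exact h
      · exact absurd (hab ⟨by linarith, h⟩) hb'
    rw [h1, h2]
  have hcount : S.Countable := hdisj.countable_of_isOpen (fun _ _ => isOpen_Ioo)
    fun p hp => nonempty_Ioo.2 hp.2.1
  obtain ⟨e, he⟩ := Set.countable_iff_exists_injOn.1 hcount
  have hinv : ∀ p ∈ S, Function.invFunOn e S (e p) = p := fun p hp =>
    he.leftInvOn_invFunOn hp
  refine ⟨e '' S, fun k => (Function.invFunOn e S k).1, fun k => (Function.invFunOn e S k).2,
    ?_, ?_, ?_, ?_⟩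
  · rintro _ ⟨p, hp, rfl⟩
    simp only [hinv p hp]
    exact ⟨hp.1, hp.2.1⟩
  · rintro _ ⟨p, hp, rfl⟩ _ ⟨q, hq, rfl⟩ hne
    simp only [Function.onFun, hinv p hp, hinv q hq]
    exact hdisj hp hq fun h => hne (by rw [h])
  · ext t
    simp only [mem_iUnion, mem_image, exists_prop]
    constructor
    · intro ht
      have ht0 : 0 < t := hE0 ht
      have h0 : (0 : ℝ) ∉ E := fun h => lt_irrefl (0 : ℝ) (hE0 h)
      have hcl : IsClosed Eᶜ := hE.isClosed_compl
      obtain ⟨s, hts, hs⟩ := hE' t ht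
      have hne1 : (Eᶜ ∩ Ici t).Nonempty := ⟨s, hs, hts.le⟩
      have hbd1 : BddBelow (Eᶜ ∩ Ici t) := ⟨t, fun x hx => hx.2⟩
      have hne2 : (Eᶜ ∩ Iic t).Nonempty := ⟨0, h0, ht0.le⟩
      have hbd2 : BddAbove (Eᶜ ∩ Iic t) := ⟨t, fun x hx => hx.2⟩
      have hd := (hcl.inter isClosed_Ici).csInf_mem hne1 hbd1
      have hc := (hcl.inter isClosed_Iic).csSup_mem hne2 hbd2
      set d := sInf (Eᶜ ∩ Ici t)
      set c := sSup (Eᶜ ∩ Iic t)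
      have htd : t < d := lt_of_le_of_ne hd.2 fun h => hd.1 (h ▸ ht)
      have hct : c < t := lt_of_le_of_ne hc.2 fun h => hc.1 (h ▸ ht)
      have hS : (c, d) ∈ S := by
        refine ⟨le_csSup hbd2 ⟨h0, ht0.le⟩, hct.trans htd, hc.1, hd.1,
          fun x hx => ?_⟩
        by_contra hxE
        rcases le_total t x with h | h
        · exact absurd (csInf_le hbd1 ⟨hxE, h⟩) (not_le.2 hx.2)
        · exact absurd (le_csSup hbd2 ⟨hxE, h⟩) (not_le.2 hx.1)
      exact ⟨e (c, d), ⟨_, hS, rfl⟩, by rw [hinv _ hS]; exact ⟨hct, htd⟩⟩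
    · rintro ⟨_, ⟨p, hp, rfl⟩, ht⟩
      rw [hinv p hp] at ht
      exact hp.2.2.2.2 ht
  · rintro _ ⟨p, hp, rfl⟩
    simp only [hinv p hp]
    exact hp.2.2.2.1

/-- An upper semicontinuous function whose values near infinity are eventually dominated by each
other attains its supremum on every half-line `[t, ∞)`, `t > 0`. -/
lemma exists_ge_iSup_eq_of_eventually_le {F : ℝ → ℝ≥0∞}
    (hF : UpperSemicontinuousOn F (Ioi 0))
    (hinf : ∃ T, ∀ t > T, ∃ R, ∀ r > R, F r ≤ F t) {t : ℝ} (ht : 0 < t) :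
    ∃ s ≥ t, ⨆ r ∈ Ici t, F r = F s := by
  obtain ⟨T, hT⟩ := hinf
  set u := max t (T + 1)
  obtain ⟨R, hR⟩ := hT u (by have := le_max_right t (T + 1); linarith)
  have htu : t ≤ u := le_max_left _ _
  have huR : u ≤ max u R := le_max_left _ _
  obtain ⟨s, hs, hmax⟩ := (hF.mono (show Icc t (max u R) ⊆ Ioi 0 from
    fun x hx => lt_of_lt_of_le ht hx.1)).exists_isMaxOn
    (nonempty_Icc.2 (htu.trans huR)) isCompact_Icc
  refine ⟨s, hs.1, le_antisymm (iSup₂_le fun r hr => ?_) (le_iSup₂_of_le s hs.1 le_rfl)⟩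
  rcases le_or_gt r (max u R) with h | h
  · exact isMaxOn_iff.1 hmax r ⟨hr, h⟩
  · exact (hR r (lt_of_le_of_lt (le_max_right _ _) h)).trans (isMaxOn_iff.1 hmax u ⟨htu, huR⟩)

lemma distrib_antitone (f : ℝ → ℝ≥0∞) : Antitone (distrib f) := fun _ _ hab =>
  measure_mono fun _ hx => ⟨hx.1, hab.trans_lt hx.2⟩

lemma rearr_antitone (f : ℝ → ℝ≥0∞) : Antitone (rearr f) := fun _ _ hab =>
  sInf_le_sInf fun _ hs => le_trans hs (ENNReal.ofReal_le_ofReal hab)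

lemma rearr_eq_zero {f : ℝ → ℝ≥0∞} {t : ℝ}
    (ht : volume {t : ℝ | t ∈ Ioi (0 : ℝ) ∧ f t ≠ 0} ≤ ENNReal.ofReal t) : rearr f t = 0 := by
  refine le_antisymm (sInf_le ?_) zero_le
  simpa only [mem_ofPred_eq, distrib, pos_iff_ne_zero] using ht

lemma RI_congr_Ioi {I J : ℝ → ℝ} (h : ∀ t > 0, I t = J t) : RI I = RI J := by
  funext φ t
  rcases lt_or_ge 0 t with ht | ht
  · simp only [RI, h t ht]
  · simp [RI, Ioc_eq_empty_of_le ht]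

section IteratedAverage

variable {J : ℝ → ℝ}

/-- Finiteness of `∫_0^t φ` for one `t > 0` implies finiteness for all `t`. -/
def FiniteNearZeroImpliesFinite (φ : ℝ → ℝ≥0∞) : Prop :=
  ∀ ε T : ℝ, 0 < ε → ∫⁻ s in Ioc 0 ε, φ s ≠ ∞ → ∫⁻ s in Ioc 0 T, φ s ≠ ∞

lemma finiteNearZeroImpliesFinite_of_bound {φ : ℝ → ℝ≥0∞}
    (h : ∀ ε T : ℝ, 0 < ε → ∫⁻ s in Ioc 0 ε, φ s ≠ ∞ →
      ∃ C : ℝ≥0∞, C ≠ ∞ ∧ ∀ s ∈ Ioc ε T, φ s ≤ C) : FiniteNearZeroImpliesFinite φ := by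
  intro ε T hε hfin
  obtain ⟨C, hC, hb⟩ := h ε T hε hfin
  have h1 : ∫⁻ s in Ioc 0 T, φ s ≤ (∫⁻ s in Ioc 0 ε, φ s) + ∫⁻ s in Ioc ε T, φ s :=
    le_trans (lintegral_mono_set (Ioc_subset_Ioc_union_Ioc (b := ε))) (lintegral_union_le _ _ _)
  have h2 : ∫⁻ s in Ioc ε T, φ s ≤ C * volume (Ioc ε T) := by
    rw [← setLIntegral_const]
    exact setLIntegral_mono measurable_const hb
  refine ne_top_of_le_ne_top (ENNReal.add_ne_top.2 ⟨hfin, ?_⟩) h1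
  refine ne_top_of_le_ne_top (ENNReal.mul_ne_top hC ?_) h2
  simp

lemma Antitone.finiteNearZeroImpliesFinite {g : ℝ → ℝ≥0∞} (hg : Antitone g) :
    FiniteNearZeroImpliesFinite g := by
  refine finiteNearZeroImpliesFinite_of_bound fun ε T hε hfin => ⟨g ε, fun htop => hfin ?_,
    fun s hs => hg hs.1.le⟩
  have : ∫⁻ s in Ioc 0 ε, (∞ : ℝ≥0∞) ≤ ∫⁻ s in Ioc 0 ε, g s :=
    setLIntegral_mono hg.measurable fun s hs => htop ▸ hg hs.2
  rw [setLIntegral_const, Real.volume_Ioc, ENNReal.top_mul (by simpa using hε)] at this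
  exact top_le_iff.1 this

lemma FiniteNearZeroImpliesFinite.RI (hJ : Monotone J) (hpos : ∀ t > 0, 0 < J t)
    {φ : ℝ → ℝ≥0∞} (hφ : FiniteNearZeroImpliesFinite φ) :
    FiniteNearZeroImpliesFinite (RI J φ) := by
  refine finiteNearZeroImpliesFinite_of_bound fun ε T hε hfin => ?_
  have hne : ∃ u ∈ Ioc 0 ε, _root_.RI J φ u ≠ ∞ := by
    by_contra! h
    refine hfin ?_
    rw [setLIntegral_congr_fun measurableSet_Ioc h, setLIntegral_const, Real.volume_Ioc,
      ENNReal.top_mul (by simpa using hε)]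
  obtain ⟨u, hu, hfu⟩ := hne
  have hu' : ∫⁻ s in Ioc 0 u, φ s ≠ ∞ := fun h => hfu <| by
    simp only [_root_.RI, h]
    exact ENNReal.top_div_of_ne_top ENNReal.ofReal_ne_top
  refine ⟨(∫⁻ s in Ioc 0 T, φ s) / ENNReal.ofReal (J ε), ENNReal.div_ne_top (hφ u T hu.1 hu')
    (by simpa using hpos ε hε), fun s hs => ?_⟩
  exact ENNReal.div_le_div (lintegral_mono_set (Ioc_subset_Ioc_right hs.2))
    (ENNReal.ofReal_le_ofReal (hJ hs.1.le))

lemma FiniteNearZeroImpliesFinite.iterate_RI (hJ : Monotone J) (hpos : ∀ t > 0, 0 < J t)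
    {φ : ℝ → ℝ≥0∞} (hφ : FiniteNearZeroImpliesFinite φ) (n : ℕ) :
    FiniteNearZeroImpliesFinite ((_root_.RI J)^[n] φ) := by
  induction n with
  | zero => exact hφ
  | succ n ih =>
    rw [Function.iterate_succ_apply']
    exact ih.RI hJ hpos

lemma FiniteNearZeroImpliesFinite.upperSemicontinuousOn_RI (hJ : Monotone J)
    (hpos : ∀ t > 0, 0 < J t) (hlc : ∀ t > 0, Tendsto J (𝓝[<] t) (𝓝 (J t)))
    {φ : ℝ → ℝ≥0∞} (hφ : FiniteNearZeroImpliesFinite φ) :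
    UpperSemicontinuousOn (_root_.RI J φ) (Ioi 0) := by
  intro t ht c hc
  rw [mem_Ioi] at ht
  have hJt : ENNReal.ofReal (J t) ≠ 0 := by simpa using hpos t ht
  have hfin : ∀ T, ∫⁻ s in Ioc 0 T, φ s ≠ ∞ := fun T => hφ t T ht fun h => by
    simp only [_root_.RI, h, ENNReal.top_div_of_ne_top ENNReal.ofReal_ne_top] at hc
    exact not_top_lt hc
  refine Filter.Eventually.filter_mono nhdsWithin_le_nhds ?_
  rw [← nhdsLT_sup_nhdsGE, ← Ioi_insert, nhdsWithin_insert, eventually_sup, eventually_sup]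
  refine ⟨?_, by simpa using hc, ?_⟩
  · have h1 : Tendsto (fun x => (∫⁻ s in Ioc 0 t, φ s) / ENNReal.ofReal (J x)) (𝓝[<] t)
        (𝓝 (_root_.RI J φ t)) :=
      ENNReal.Tendsto.const_div (ENNReal.tendsto_ofReal (hlc t ht)) (Or.inr (hfin t))
    filter_upwards [h1.eventually_lt_const hc, self_mem_nhdsWithin] with x hx hxt
    refine lt_of_le_of_lt ?_ hx
    exact ENNReal.div_le_div_right (lintegral_mono_set (Ioc_subset_Ioc_right (le_of_lt hxt))) _
  · have h0 : Tendsto (fun x => ∫⁻ s in Ioc 0 x, φ s) (𝓝[>] t) (𝓝 (∫⁻ s in Ioc 0 t, φ s)) := by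
      have := tendsto_measure_biInter_gt (μ := volume.withDensity φ) (s := fun x => Ioc 0 x)
        (a := t) (fun r _ => measurableSet_Ioc.nullMeasurableSet)
        (fun i j _ hij => Ioc_subset_Ioc_right hij)
        ⟨t + 1, by linarith, by rw [withDensity_apply _ measurableSet_Ioc]; exact hfin _⟩
      have hinter : (⋂ r > t, Ioc 0 r) = Ioc 0 t := by
        ext x
        simp only [mem_iInter, mem_Ioc]
        exact ⟨fun h => ⟨(h (t + 1) (by linarith)).1,
            le_of_forall_gt_imp_ge_of_dense fun r hr => (h r hr).2⟩,
          fun h r hr => ⟨h.1, h.2.trans (le_of_lt hr)⟩⟩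
      rw [hinter, withDensity_apply _ measurableSet_Ioc] at this
      refine this.congr fun x => ?_
      simp only [Function.comp, withDensity_apply _ measurableSet_Ioc]
    have h1 : Tendsto (fun x => (∫⁻ s in Ioc 0 x, φ s) / ENNReal.ofReal (J t)) (𝓝[>] t)
        (𝓝 (_root_.RI J φ t)) := ENNReal.Tendsto.div_const h0 (Or.inr hJt)
    filter_upwards [h1.eventually_lt_const hc, self_mem_nhdsWithin] with x hx hxt
    refine lt_of_le_of_lt ?_ hx
    exact ENNReal.div_le_div_left (ENNReal.ofReal_le_ofReal (hJ (le_of_lt hxt))) _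

/-- The kernel `K_n(s,t)` of the iterates of `RI J`: `K_0 = 1` and
`K_{n+1}(s,t) = ∫_s^t K_n(s,u)/J(u) du`. -/
def iterKernel (J : ℝ → ℝ) : ℕ → ℝ × ℝ → ℝ≥0∞
  | 0, _ => 1
  | n + 1, p => ∫⁻ u, (Icc p.1 p.2).indicator
      (fun u => iterKernel J n (p.1, u) / ENNReal.ofReal (J u)) u

lemma measurable_iterKernel (hJ : Measurable J) (n : ℕ) : Measurable (iterKernel J n) := by
  induction n with
  | zero => exact measurable_const
  | succ n ih =>
    have : Measurable fun q : (ℝ × ℝ) × ℝ =>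
        {q : (ℝ × ℝ) × ℝ | q.1.1 ≤ q.2 ∧ q.2 ≤ q.1.2}.indicator
        (fun q => iterKernel J n (q.1.1, q.2) / ENNReal.ofReal (J q.2)) q := by
      refine Measurable.indicator ?_ ?_
      · fun_prop
      · exact (measurableSet_le (by fun_prop : Measurable fun q : (ℝ × ℝ) × ℝ => q.1.1)
          measurable_snd).inter (measurableSet_le measurable_snd
            (by fun_prop : Measurable fun q : (ℝ × ℝ) × ℝ => q.1.2))
    exact this.lintegral_prod_right'

lemma iterate_RI_eq_lintegral_iterKernel (hJ : Measurable J) {g : ℝ → ℝ≥0∞} (hg : Measurable g)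
    (n : ℕ) (t : ℝ) : (RI J)^[n + 1] g t =
      (∫⁻ s in Ioc 0 t, g s * iterKernel J n (s, t)) / ENNReal.ofReal (J t) := by
  induction n generalizing t with
  | zero => simp [RI, iterKernel]
  | succ n ih =>
    rw [Function.iterate_succ_apply']
    simp only [RI]
    congr 1
    have hK := measurable_iterKernel hJ n
    let k : ℝ → ℝ → ℝ≥0∞ := fun u s =>
      {p : ℝ × ℝ | p.2 ≤ p.1}.indicator
        (fun p => g p.2 * (iterKernel J n (p.2, p.1) / ENNReal.ofReal (J p.1))) (u, s)
    have hk : Measurable (Function.uncurry k) := by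
      refine Measurable.indicator ?_ (measurableSet_le measurable_snd measurable_fst)
      fun_prop
    calc ∫⁻ u in Ioc 0 t, (RI J)^[n + 1] g u
        = ∫⁻ u in Ioc 0 t, ∫⁻ s in Ioc 0 t, k u s := by
          refine setLIntegral_congr_fun measurableSet_Ioc fun u hu => ?_
          rw [ih u, div_eq_mul_inv, ← lintegral_mul_const _ (by fun_prop),
            ← lintegral_indicator measurableSet_Ioc, ← lintegral_indicator measurableSet_Ioc]
          refine lintegral_congr fun s => ?_
          by_cases h1 : s ∈ Ioc 0 u
          · have h2 : s ∈ Ioc 0 t := ⟨h1.1, h1.2.trans hu.2⟩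
            simp only [k, indicator_of_mem h1, indicator_of_mem h2]
            rw [indicator_of_mem (show (u, s) ∈ {p : ℝ × ℝ | p.2 ≤ p.1} from h1.2),
              div_eq_mul_inv, mul_assoc]
          · rw [indicator_of_notMem h1]
            by_cases h2 : s ∈ Ioc 0 t
            · rw [indicator_of_mem h2]
              exact (indicator_of_notMem
                (show (u, s) ∉ {p : ℝ × ℝ | p.2 ≤ p.1} from fun h => h1 ⟨h2.1, h⟩) _).symm
            · rw [indicator_of_notMem h2]
      _ = ∫⁻ s in Ioc 0 t, ∫⁻ u in Ioc 0 t, k u s :=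
          lintegral_lintegral_swap hk.aemeasurable
      _ = ∫⁻ s in Ioc 0 t, g s * iterKernel J (n + 1) (s, t) := by
          refine setLIntegral_congr_fun measurableSet_Ioc fun s hs => ?_
          simp only [iterKernel]
          rw [← lintegral_const_mul _ (Measurable.indicator (by fun_prop) measurableSet_Icc),
            ← lintegral_indicator measurableSet_Ioc]
          refine lintegral_congr fun u => ?_
          by_cases h1 : u ∈ Icc s t
          · have h2 : u ∈ Ioc 0 t := ⟨hs.1.trans_le h1.1, h1.2⟩
            rw [indicator_of_mem h1, indicator_of_mem h2]
            exact indicator_of_mem (show (u, s) ∈ {p : ℝ × ℝ | p.2 ≤ p.1} from h1.1) _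
          · rw [indicator_of_notMem h1, mul_zero]
            by_cases h2 : u ∈ Ioc 0 t
            · rw [indicator_of_mem h2]
              exact indicator_of_notMem
                (show (u, s) ∉ {p : ℝ × ℝ | p.2 ≤ p.1} from fun h => h1 ⟨h, h2.2⟩) _
            · rw [indicator_of_notMem h2]

lemma antitoneOn_one_div (hJ : Monotone J) (hpos : ∀ t > 0, 0 < J t) :
    AntitoneOn (fun x => 1 / J x) (Ioi 0) := fun x hx _ _ hxy =>
  one_div_le_one_div_of_le (hpos x hx) (hJ hxy)

lemma intervalIntegrable_one_div (hJ : Monotone J) (hpos : ∀ t > 0, 0 < J t) {s t : ℝ}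
    (hs : 0 < s) (hst : s ≤ t) : IntervalIntegrable (fun x => 1 / J x) volume s t := by
  refine ((antitoneOn_one_div hJ hpos).mono ?_).intervalIntegrable
  rw [uIcc_of_le hst]
  exact fun x hx => hs.trans_le hx.1

lemma integral_one_div_nonneg (hpos : ∀ t > 0, 0 < J t) {s t : ℝ}
    (hs : 0 < s) (hst : s ≤ t) : 0 ≤ ∫ x in s..t, 1 / J x :=
  intervalIntegral.integral_nonneg hst fun x hx => (one_div_pos.2 (hpos x (hs.trans_le hx.1))).le

lemma continuousOn_primitive_one_div (hJ : Monotone J) (hpos : ∀ t > 0, 0 < J t) {s t : ℝ}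
    (hs : 0 < s) (hst : s ≤ t) : ContinuousOn (fun u => ∫ x in s..u, 1 / J x) (Icc s t) := by
  have := intervalIntegral.continuousOn_primitive_interval (μ := volume) (a := s) (b := t)
    (f := fun x => 1 / J x) (by
      rw [uIcc_of_le hst]
      exact (intervalIntegrable_iff_integrableOn_Icc_of_le hst).1
        (intervalIntegrable_one_div hJ hpos hs hst))
  rwa [uIcc_of_le hst] at this

lemma integral_primitive_pow_mul (hJ : Monotone J) (hpos : ∀ t > 0, 0 < J t) {s t : ℝ}
    (hs : 0 < s) (hst : s ≤ t) (n : ℕ) :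
    IntervalIntegrable (fun u => (∫ x in s..u, 1 / J x) ^ n / n.factorial * (1 / J u)) volume s t ∧
    ∫ u in s..t, (∫ x in s..u, 1 / J x) ^ n / n.factorial * (1 / J u) =
      (∫ x in s..t, 1 / J x) ^ (n + 1) / (n + 1).factorial := by
  have hc := continuousOn_primitive_one_div hJ hpos hs hst
  have hint : IntervalIntegrable
      (fun u => (∫ x in s..u, 1 / J x) ^ n / n.factorial * (1 / J u)) volume s t := by
    refine (intervalIntegrable_one_div hJ hpos hs hst).continuousOn_mul ?_
    rw [uIcc_of_le hst]
    exact (hc.pow n).div_const _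
  refine ⟨hint, ?_⟩
  have key := integral_eq_of_hasDerivAt_off_countable_of_le
    (fun u => (∫ x in s..u, 1 / J x) ^ (n + 1) / (n + 1).factorial)
    (fun u => (∫ x in s..u, 1 / J x) ^ n / n.factorial * (1 / J u)) hst
    hJ.countable_not_continuousAt ((hc.pow (n + 1)).div_const _) ?_ hint
  · rw [key]
    simp
  · rintro u ⟨⟨hsu, hut⟩, hu⟩
    have hcont : ContinuousAt J u := by simpa using hu
    have hu0 : 0 < u := hs.trans hsu
    have hd : HasDerivAt (fun u => ∫ x in s..u, 1 / J x) (1 / J u) u :=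
      intervalIntegral.integral_hasDerivAt_right
        (intervalIntegrable_one_div hJ hpos hs hsu.le)
        ((hJ.measurable.const_div 1).stronglyMeasurable.stronglyMeasurableAtFilter)
        (continuousAt_const.div hcont (hpos u hu0).ne')
    refine ((hd.pow (n + 1)).div_const ((n + 1).factorial : ℝ)).congr_deriv ?_
    have : (n.factorial : ℝ) ≠ 0 := by positivity
    rw [Nat.factorial_succ]
    push_cast
    field_simp

lemma iterKernel_eq (hJ : Monotone J) (hpos : ∀ t > 0, 0 < J t) {s t : ℝ}
    (hs : 0 < s) (hst : s ≤ t) (n : ℕ) :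
    iterKernel J n (s, t) = ENNReal.ofReal ((∫ x in s..t, 1 / J x) ^ n / n.factorial) := by
  induction n generalizing t with
  | zero => simp [iterKernel]
  | succ n ih =>
    obtain ⟨hint, heq⟩ := integral_primitive_pow_mul hJ hpos hs hst n
    rw [← heq, intervalIntegral.integral_of_le hst, ofReal_integral_eq_lintegral_ofReal hint.1]
    · simp only [iterKernel]
      rw [lintegral_indicator measurableSet_Icc, setLIntegral_congr Ioc_ae_eq_Icc.symm]
      refine setLIntegral_congr_fun measurableSet_Ioc fun u hu => ?_
      have hu0 := hpos u (hs.trans hu.1)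
      rw [ih hu.1.le, ENNReal.ofReal_mul' (one_div_pos.2 hu0).le, one_div,
        ENNReal.ofReal_inv_of_pos hu0, div_eq_mul_inv]
    · refine (ae_restrict_mem measurableSet_Ioc).mono fun u hu => ?_
      have := integral_one_div_nonneg hpos hs hu.1.le
      have := hpos u (hs.trans hu.1)
      simp only [Pi.zero_apply]
      positivity

lemma iterate_RI_eq_lintegral_Phi (hJ : Monotone J) (hpos : ∀ t > 0, 0 < J t)
    {g : ℝ → ℝ≥0∞} (hg : Measurable g) (n : ℕ) {a t : ℝ} (ht : 0 < t) (hat : a ≤ t)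
    (ha : ∀ s ≥ a, g s = 0) :
    (RI J)^[n + 1] g t =
      ∫⁻ s in Ioo 0 a, g s * ENNReal.ofReal (Phi J (n + 1) t s / n.factorial) := by
  have hJt := hpos t ht
  have hK := measurable_iterKernel hJ.measurable n
  rw [iterate_RI_eq_lintegral_iterKernel hJ.measurable hg, div_eq_mul_inv,
    ← lintegral_mul_const _ (by fun_prop),
    ← lintegral_indicator measurableSet_Ioc, ← lintegral_indicator measurableSet_Ioo]
  refine lintegral_congr fun s => ?_
  by_cases h1 : s ∈ Ioo 0 a
  · have h2 : s ∈ Ioc 0 t := ⟨h1.1, h1.2.le.trans hat⟩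
    rw [indicator_of_mem h1, indicator_of_mem h2, iterKernel_eq hJ hpos h2.1 h2.2, mul_assoc,
      ← ENNReal.ofReal_inv_of_pos hJt, ← ENNReal.ofReal_mul' (inv_nonneg.2 hJt.le)]
    simp only [Phi, Nat.add_sub_cancel]
    congr 2
    ring
  · rw [indicator_of_notMem h1]
    by_cases h2 : s ∈ Ioc 0 t
    · rw [indicator_of_mem h2, ha s (not_lt.1 fun h => h1 ⟨h2.1, h⟩)]
      simp
    · rw [indicator_of_notMem h2]

lemma exists_eventually_iterate_RI_le (hJ : Monotone J) (hpos : ∀ t > 0, 0 < J t)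
    {g : ℝ → ℝ≥0∞} (hg : Measurable g) {n : ℕ} {a : ℝ} (ha0 : 0 < a) (ha : ∀ s ≥ a, g s = 0)
    (hPhi : EssentiallyDecreasingIn J (n + 1)) :
    ∃ T, ∀ t > T, ∃ R, ∀ r > R, (RI J)^[n + 1] g r ≤ (RI J)^[n + 1] g t := by
  obtain ⟨t₀, -, h⟩ := hPhi a ha0
  refine ⟨max t₀ a, fun t ht => ?_⟩
  obtain ⟨ht0, hta⟩ := max_lt_iff.1 ht
  obtain ⟨R, -, hR⟩ := h t ht0
  refine ⟨max R a, fun r hr => ?_⟩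
  obtain ⟨hrR, hra⟩ := max_lt_iff.1 hr
  rw [iterate_RI_eq_lintegral_Phi hJ hpos hg n (ha0.trans hra) hra.le ha,
    iterate_RI_eq_lintegral_Phi hJ hpos hg n (ha0.trans hta) hta.le ha]
  refine setLIntegral_mono' measurableSet_Ioo fun s hs => ?_
  gcongr
  exact hR r hrR s hs

end IteratedAverage

lemma Phi_congr_Ioi {I J : ℝ → ℝ} (h : ∀ t > 0, I t = J t) (m : ℕ) {s t : ℝ} (hs : 0 < s)
    (ht : 0 < t) : Phi I m t s = Phi J m t s := by
  simp only [Phi, h t ht]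
  congr 2
  refine intervalIntegral.integral_congr fun x hx => ?_
  simp only [h x ((lt_min hs ht).trans_le hx.1)]

lemma EssentiallyDecreasingIn.congr_Ioi {I J : ℝ → ℝ} (h : ∀ t > 0, I t = J t) {m : ℕ}
    (hI : EssentiallyDecreasingIn I m) : EssentiallyDecreasingIn J m := by
  intro s₀ hs₀
  obtain ⟨t₀, ht₀, H⟩ := hI s₀ hs₀
  refine ⟨t₀, ht₀, fun t ht => ?_⟩
  obtain ⟨R, hR, H'⟩ := H t ht
  refine ⟨R, hR, fun r hr s hs => ?_⟩
  rw [← Phi_congr_Ioi h m hs.1 (lt_trans hR hr), ← Phi_congr_Ioi h m hs.1 (lt_trans ht₀ ht)]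
  exact H' r hr s hs

/-- structure of the set where `R_I^m f* < G_I^m f`. -/
theorem statement6 (m : ℕ) (hm : 1 ≤ m) (I : ℝ → ℝ)
    (hI : MonotoneOn I (Set.Ioi 0))
    (hIpos : ∀ t ∈ Set.Ioi (0 : ℝ), 0 < I t)
    (hIlc : ∀ t ∈ Set.Ioi (0 : ℝ), Filter.Tendsto I (𝓝[<] t) (𝓝 (I t)))
    (hPhi : EssentiallyDecreasingIn I m)
    (f : ℝ → ℝ≥0∞) (hf : Measurable f)
    (hsupp : volume {t : ℝ | t ∈ Set.Ioi (0 : ℝ) ∧ f t ≠ 0} < ∞) :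
    IsOpen (exceptionalSet I m f) ∧
    ∃ (K : Set ℕ) (c d : ℕ → ℝ),
      (∀ k ∈ K, 0 ≤ c k ∧ c k < d k) ∧
      (K.PairwiseDisjoint fun k => Set.Ioo (c k) (d k)) ∧
      (exceptionalSet I m f = ⋃ k ∈ K, Set.Ioo (c k) (d k)) ∧
      (∀ t ∈ Set.Ioi (0 : ℝ), t ∉ exceptionalSet I m f →
        GI I m f t = (RI I)^[m] (rearr f) t) ∧
      ∀ k ∈ K, ∀ t ∈ Set.Ioo (c k) (d k),
        GI I m f t = (RI I)^[m] (rearr f) (d k) := by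
  obtain ⟨n, rfl⟩ : ∃ n, m = n + 1 := ⟨m - 1, by omega⟩
  -- Extending `I` by zero makes it globally monotone without changing `RI I`.
  let J : ℝ → ℝ := fun t => if 0 < t then I t else 0
  have hIJ : ∀ t > 0, I t = J t := fun t ht => (if_pos ht).symm
  have hpos : ∀ t > 0, 0 < J t := fun t ht => hIJ t ht ▸ hIpos t ht
  have hJ : Monotone J := by
    intro x y hxy
    rcases lt_or_ge 0 x with hx | hx
    · rw [← hIJ x hx, ← hIJ y (hx.trans_le hxy)]
      exact hI hx (hx.trans_le hxy) hxy
    · simp only [J, if_neg hx.not_gt]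
      split_ifs with hy
      · exact (hIpos y hy).le
      · exact le_rfl
  have hlc : ∀ t > 0, Tendsto J (𝓝[<] t) (𝓝 (J t)) := by
    intro t ht
    rw [← hIJ t ht]
    refine (hIlc t ht).congr' ?_
    filter_upwards [nhdsWithin_le_nhds (Ioi_mem_nhds ht)] with x hx using hIJ x hx
  have hg := rearr_antitone f
  set F := (RI I)^[n + 1] (rearr f) with hFdef
  have husc : UpperSemicontinuousOn F (Ioi 0) := by
    rw [hFdef, RI_congr_Ioi hIJ, Function.iterate_succ_apply']
    exact (hg.finiteNearZeroImpliesFinite.iterate_RI hJ hpos n).upperSemicontinuousOn_RI hJ hpos hlc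
  have hinf : ∃ T, ∀ t > T, ∃ R, ∀ r > R, F r ≤ F t := by
    set v := volume {t : ℝ | t ∈ Set.Ioi (0 : ℝ) ∧ f t ≠ 0}
    rw [hFdef, RI_congr_Ioi hIJ]
    refine exists_eventually_iterate_RI_le (a := v.toReal + 1) hJ hpos hg.measurable
      (by positivity) (fun s hs => rearr_eq_zero ?_) (hPhi.congr_Ioi hIJ)
    rw [ENNReal.le_ofReal_iff_toReal_le hsupp.ne (by linarith [v.toReal_nonneg])]
    linarith
  have hatt : ∀ t > 0, ∃ s ≥ t, GI I (n + 1) f t = F s := fun t ht =>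
    exists_ge_iSup_eq_of_eventually_le husc hinf ht
  have hle : ∀ t s, t ≤ s → F s ≤ GI I (n + 1) f t := fun t s hts =>
    le_iSup₂_of_le (f := fun s (_ : s ∈ Ici t) => F s) s hts le_rfl
  have hanti : Antitone (GI I (n + 1) f) := fun t s hts =>
    iSup₂_le fun r hr => hle t r (le_trans hts hr)
  set E := exceptionalSet I (n + 1) f with hE
  have hnot : ∀ t ∈ Ioi (0 : ℝ), t ∉ E → GI I (n + 1) f t = F t := fun t ht htE =>
    le_antisymm (not_lt.1 fun h => htE ⟨ht, h⟩) (hle t t le_rfl)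
  have hright : ∀ t ∈ E, ∃ s, t < s ∧ s ∉ E ∧ GI I (n + 1) f t = F s := by
    rintro t ⟨ht, hlt⟩
    obtain ⟨s, hts, hs⟩ := hatt t ht
    refine ⟨s, lt_of_le_of_ne hts fun h => ?_, fun hsE => ?_, hs⟩
    · rw [hs, ← h] at hlt
      exact lt_irrefl _ hlt
    · exact absurd (hsE.2.trans_le (hanti hts)) (hs ▸ lt_irrefl _)
  have hopen : IsOpen E := by
    rw [isOpen_iff_mem_nhds]
    intro t htE
    obtain ⟨s, hts, -, hs⟩ := hright t htE
    have ht : 0 < t := htE.1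
    have h1 : ∀ᶠ x in 𝓝 t, F x < F s := by
      have := husc t ht (F s) (hs ▸ htE.2)
      rwa [(isOpen_Ioi.nhdsWithin_eq ht)] at this
    filter_upwards [h1, Ioi_mem_nhds ht, Iio_mem_nhds hts] with x hx hx0 hxs
    exact ⟨hx0, hx.trans_le (hle x s (le_of_lt hxs))⟩
  obtain ⟨K, c, d, hcd, hdisj, hun, hd⟩ := exists_disjoint_Ioo_decomposition hopen
    (fun t ht => ht.1) fun t ht => let ⟨s, h1, h2, _⟩ := hright t ht; ⟨s, h1, h2⟩
  refine ⟨hopen, K, c, d, hcd, hdisj, hun, hnot, fun k hk t ht => ?_⟩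
  have hsub : Ioo (c k) (d k) ⊆ E := fun x hx => by
    rw [hun]
    exact mem_biUnion hk hx
  obtain ⟨s, hts, hsE, hs⟩ := hright t (hsub ht)
  have hds : d k ≤ s := not_lt.1 fun h => hsE (hsub ⟨ht.1.trans hts, h⟩)
  have hd0 : 0 < d k := (hcd k hk).1.trans_lt (hcd k hk).2
  rw [← hnot (d k) hd0 (hd k hk)]
  exact le_antisymm (hs ▸ hle _ _ hds) (hanti ht.2.le)
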